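/- Suppose that for some k ∈ ℕ we have N_{k+1} = 0 and N_{k+2} = 0, where the N_j are the recursively defined fusion matrices of the graph 𝒜⁽ⁿ⁾ (n = k+3). Then, as polynomials with coefficients in the (noncommutative) matrix ring Matrix V_k V_k ℤ, one has the Hilbert-series identity (1 − Δ·t + Δᵀ·t² − 1·t³) · (Σ_{j=0}^{k} N_j·t^j) = 1 − P·t^{k+3}, where P is the permutation matrix of the bijection σ : V_k → V_k, σ(p,l) = (k−p−l, p), i.e. P((p,l),(p',l')) = 1 if (p',l') = (k−p−l, p) and 0 otherwise. (This is the paper's Hilbert series theorem H_A(t) = (1 − P t^h)/(1 − Δt + Δᵀt² − t³) for the graph 𝒜⁽ⁿ⁾, whose permutation P = V² is the square of the clockwise rotation V of the graph by 2π/3.) -/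

import Mathlib

open scoped Matrix

/-- Vertices of the SU(3) graph `𝒜⁽ⁿ⁾` (with `n = k + 3`): pairs `(p, l)` of naturals
with `p + l ≤ k`, encoded inside `Fin (k+1) × Fin (k+1)`. -/
abbrev GraphAVertex (k : ℕ) : Type :=
  {v : Fin (k + 1) × Fin (k + 1) // (v.1 : ℕ) + (v.2 : ℕ) ≤ k}

/-- Adjacency matrix `Δ` of the graph `𝒜⁽ⁿ⁾`: there is an edge `(p,l) → (p',l')` iff
`(p',l')` is `(p+1,l)`, `(p−1,l+1)` (requiring `p ≥ 1`) or `(p,l−1)` (requiring `l ≥ 1`). -/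
def graphAAdj (k : ℕ) : Matrix (GraphAVertex k) (GraphAVertex k) ℤ := fun v w =>
  if ((w.1.1 : ℕ) = (v.1.1 : ℕ) + 1 ∧ (w.1.2 : ℕ) = (v.1.2 : ℕ))
      ∨ (1 ≤ (v.1.1 : ℕ) ∧ (w.1.1 : ℕ) + 1 = (v.1.1 : ℕ) ∧ (w.1.2 : ℕ) = (v.1.2 : ℕ) + 1)
      ∨ (1 ≤ (v.1.2 : ℕ) ∧ (w.1.1 : ℕ) = (v.1.1 : ℕ) ∧ (w.1.2 : ℕ) + 1 = (v.1.2 : ℕ))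
  then 1 else 0

/-- The recursively defined fusion (nimrep) matrices `N_j` of the graph `𝒜⁽ⁿ⁾`:
`N₀ = 1`, `N₁ = Δ`, `N₂ = Δ·Δ − Δᵀ`, `N_{j+3} = Δ·N_{j+2} − Δᵀ·N_{j+1} + N_j`. -/
def graphAFusion (k : ℕ) : ℕ → Matrix (GraphAVertex k) (GraphAVertex k) ℤ
  | 0 => 1
  | 1 => graphAAdj k
  | 2 => graphAAdj k * graphAAdj k - (graphAAdj k)ᵀ
  | j + 3 =>
      graphAAdj k * graphAFusion k (j + 2) - (graphAAdj k)ᵀ * graphAFusion k (j + 1)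
        + graphAFusion k j

/-- The `ℤ₃` symmetry `σ(p,l) = (k − p − l, p)` of the graph `𝒜⁽ⁿ⁾`. -/
def graphASigma (k : ℕ) (v : GraphAVertex k) : GraphAVertex k :=
  ⟨(⟨k - (v.1.1 : ℕ) - (v.1.2 : ℕ), by omega⟩,
    ⟨(v.1.1 : ℕ), by have h := v.2; omega⟩),
    by
      have h := v.2
      show k - (v.1.1 : ℕ) - (v.1.2 : ℕ) + (v.1.1 : ℕ) ≤ k
      omega⟩

/-- The permutation matrix `P` of the bijection `σ : V_k → V_k`, `σ(p,l) = (k−p−l, p)`: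
`P((p,l),(p',l')) = 1` if `(p',l') = (k−p−l, p)` and `0` otherwise. -/
def graphAPerm (k : ℕ) : Matrix (GraphAVertex k) (GraphAVertex k) ℤ := fun v w =>
  if w = graphASigma k v then 1 else 0

namespace GraphA

open Polynomial

variable {k : ℕ}

/-- The vertex `(p, l)` of the graph `𝒜⁽ⁿ⁾`. -/
def vertex (p l : ℕ) (h : p + l ≤ k) : GraphAVertex k :=
  ⟨(⟨p, by omega⟩, ⟨l, by omega⟩), h⟩

lemma vertex_ext {v w : GraphAVertex k} (h₁ : (v.1.1 : ℕ) = w.1.1)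
    (h₂ : (v.1.2 : ℕ) = w.1.2) : v = w :=
  Subtype.ext (Prod.ext (Fin.ext h₁) (Fin.ext h₂))

lemma eq_vertex_iff {v : GraphAVertex k} {p l : ℕ} {h : p + l ≤ k} :
    v = vertex p l h ↔ (v.1.1 : ℕ) = p ∧ (v.1.2 : ℕ) = l :=
  ⟨by rintro rfl; exact ⟨rfl, rfl⟩, fun h => vertex_ext h.1 h.2⟩

/-- The partial permutation matrix of the translation `(p, l) ↦ (p + a, l + b)`. -/
def shift (k : ℕ) (a b : ℤ) : Matrix (GraphAVertex k) (GraphAVertex k) ℤ := fun v w =>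
  if (w.1.1 : ℤ) = v.1.1 + a ∧ (w.1.2 : ℤ) = v.1.2 + b then 1 else 0

lemma shift_transpose (a b : ℤ) : (shift k a b)ᵀ = shift k (-a) (-b) := by
  ext v w
  simp only [shift, Matrix.transpose_apply]
  congr 1
  apply propext
  omega

lemma shift_mul_shift_apply (a b c d : ℤ) (v w : GraphAVertex k) :
    (shift k a b * shift k c d) v w =
      if (0 ≤ v.1.1 + a ∧ 0 ≤ v.1.2 + b ∧ v.1.1 + a + (v.1.2 + b) ≤ k) ∧
        (w.1.1 : ℤ) = v.1.1 + a + c ∧ (w.1.2 : ℤ) = v.1.2 + b + d then 1 else 0 := by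
  rw [Matrix.mul_apply]
  by_cases hu : 0 ≤ v.1.1 + a ∧ 0 ≤ v.1.2 + b ∧ v.1.1 + a + (v.1.2 + b) ≤ k
  · obtain ⟨p, hp⟩ := Int.eq_ofNat_of_zero_le hu.1
    obtain ⟨l, hl⟩ := Int.eq_ofNat_of_zero_le hu.2.1
    have hpl : p + l ≤ k := by omega
    rw [Finset.sum_eq_single (vertex p l hpl)]
    · simp [shift, vertex, hp, hl]
      norm_cast
      simp [hpl]
    · intro x _ hx
      rw [Ne, eq_vertex_iff] at hx
      rw [shift, if_neg (by omega), zero_mul]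
    · simp
  · rw [if_neg (fun h => hu h.1)]
    refine Finset.sum_eq_zero fun x _ => ?_
    have := x.2
    rw [shift, if_neg (by omega), zero_mul]

lemma shift_mul_shift_eq {a b c d a' b' c' d' : ℤ} (h₁ : a + c = a' + c') (h₂ : b + d = b' + d')
    (h : ∀ p l : ℤ, 0 ≤ p → 0 ≤ l → p + l ≤ k →
      0 ≤ p + (a + c) → 0 ≤ l + (b + d) → p + (a + c) + (l + (b + d)) ≤ k →
      ((0 ≤ p + a ∧ 0 ≤ l + b ∧ p + a + (l + b) ≤ k) ↔
        (0 ≤ p + a' ∧ 0 ≤ l + b' ∧ p + a' + (l + b') ≤ k))) :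
    shift k a b * shift k c d = shift k a' b' * shift k c' d' := by
  ext v w
  rw [shift_mul_shift_apply, shift_mul_shift_apply]
  have hv := v.2
  have hw := w.2
  have key := h v.1.1 v.1.2
  congr 1
  apply propext
  constructor
  · rintro ⟨h₃, h₄, h₅⟩
    exact ⟨(key (by omega) (by omega) (by omega) (by omega) (by omega) (by omega)).1 h₃,
      by omega, by omega⟩
  · rintro ⟨h₃, h₄, h₅⟩
    exact ⟨(key (by omega) (by omega) (by omega) (by omega) (by omega) (by omega)).2 h₃,
      by omega, by omega⟩

lemma adj_eq_shift : graphAAdj k = shift k 1 0 + shift k (-1) 1 + shift k 0 (-1) := by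
  ext v w
  simp only [graphAAdj, shift, Matrix.add_apply]
  split_ifs <;> omega

lemma commute_adj_transpose : Commute (graphAAdj k) (graphAAdj k)ᵀ := by
  have e₁ : shift k 1 0 * shift k (-1) 0 = shift k 0 1 * shift k 0 (-1) :=
    shift_mul_shift_eq (by omega) (by omega) (by omega)
  have e₂ : shift k (-1) 1 * shift k 1 (-1) = shift k (-1) 0 * shift k 1 0 :=
    shift_mul_shift_eq (by omega) (by omega) (by omega)
  have e₃ : shift k 0 (-1) * shift k 0 1 = shift k 1 (-1) * shift k (-1) 1 :=
    shift_mul_shift_eq (by omega) (by omega) (by omega)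
  have e₄ : shift k 1 0 * shift k 1 (-1) = shift k 1 (-1) * shift k 1 0 :=
    shift_mul_shift_eq (by omega) (by omega) (by omega)
  have e₅ : shift k 1 0 * shift k 0 1 = shift k 0 1 * shift k 1 0 :=
    shift_mul_shift_eq (by omega) (by omega) (by omega)
  have e₆ : shift k (-1) 1 * shift k (-1) 0 = shift k (-1) 0 * shift k (-1) 1 :=
    shift_mul_shift_eq (by omega) (by omega) (by omega)
  have e₇ : shift k (-1) 1 * shift k 0 1 = shift k 0 1 * shift k (-1) 1 :=
    shift_mul_shift_eq (by omega) (by omega) (by omega)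
  have e₈ : shift k 0 (-1) * shift k (-1) 0 = shift k (-1) 0 * shift k 0 (-1) :=
    shift_mul_shift_eq (by omega) (by omega) (by omega)
  have e₉ : shift k 0 (-1) * shift k 1 (-1) = shift k 1 (-1) * shift k 0 (-1) :=
    shift_mul_shift_eq (by omega) (by omega) (by omega)
  rw [Commute, SemiconjBy, adj_eq_shift]
  simp only [Matrix.transpose_add, shift_transpose, neg_neg, neg_zero, mul_add, add_mul,
    e₁, e₂, e₃, e₄, e₅, e₆, e₇, e₈, e₉]
  abel

lemma sigma_injective : Function.Injective (graphASigma k) := by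
  intro v w h
  have h₁ : k - (v.1.1 : ℕ) - (v.1.2 : ℕ) = k - (w.1.1 : ℕ) - (w.1.2 : ℕ) :=
    congrArg (fun x : GraphAVertex k => (x.1.1 : ℕ)) h
  have h₂ : (v.1.1 : ℕ) = w.1.1 := congrArg (fun x : GraphAVertex k => (x.1.2 : ℕ)) h
  have := v.2
  have := w.2
  exact vertex_ext h₂ (by omega)

lemma adj_vertex (p l : ℕ) (h : p + l ≤ k) (w : GraphAVertex k) :
    graphAAdj k (vertex p l h) w =
      if ((w.1.1 : ℕ) = p + 1 ∧ (w.1.2 : ℕ) = l) ∨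
        (1 ≤ p ∧ (w.1.1 : ℕ) + 1 = p ∧ (w.1.2 : ℕ) = l + 1) ∨
        (1 ≤ l ∧ (w.1.1 : ℕ) = p ∧ (w.1.2 : ℕ) + 1 = l) then 1 else 0 :=
  rfl

lemma adj_transpose_vertex (p l : ℕ) (h : p + l ≤ k) (w : GraphAVertex k) :
    (graphAAdj k)ᵀ (vertex p l h) w =
      if (p = (w.1.1 : ℕ) + 1 ∧ l = (w.1.2 : ℕ)) ∨
        (1 ≤ (w.1.1 : ℕ) ∧ p + 1 = (w.1.1 : ℕ) ∧ l = (w.1.2 : ℕ) + 1) ∨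
        (1 ≤ (w.1.2 : ℕ) ∧ p = (w.1.1 : ℕ) ∧ l + 1 = (w.1.2 : ℕ)) then 1 else 0 :=
  rfl

lemma adj_sigma (v w : GraphAVertex k) :
    graphAAdj k (graphASigma k v) (graphASigma k w) = graphAAdj k v w := by
  have := v.2
  have := w.2
  simp only [graphAAdj, graphASigma]
  congr 1
  apply propext
  omega

lemma commute_perm {M : Matrix (GraphAVertex k) (GraphAVertex k) ℤ}
    (hM : ∀ v w, M (graphASigma k v) (graphASigma k w) = M v w) :
    Commute (graphAPerm k) M := by
  ext v w
  obtain ⟨w, rfl⟩ := (Finite.injective_iff_surjective.1 sigma_injective) w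
  simp [Matrix.mul_apply, graphAPerm, hM, sigma_injective.eq_iff]

lemma commute_fusion {M : Matrix (GraphAVertex k) (GraphAVertex k) ℤ}
    (h : Commute M (graphAAdj k)) (h' : Commute M (graphAAdj k)ᵀ) (j : ℕ) :
    Commute M (graphAFusion k j) := by
  induction j using graphAFusion.induct with
  | case1 => exact Commute.one_right M
  | case2 => exact h
  | case3 => exact (h.mul_right h).sub_right h'
  | case4 j ih₂ ih₁ ih₀ => exact ((h.mul_right ih₂).sub_right (h'.mul_right ih₁)).add_right ih₀

lemma row_eq_zero_of_commute {ι : Type*} [Fintype ι] {B M : Matrix ι ι ℤ}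
    (h : Commute B M) {v u : ι} (hv : M v = 0) (hu : B v u = 1)
    (hx : ∀ x, x ≠ u → B v x = 0 ∨ M x = 0) : M u = 0 := by
  ext w
  have e := congrFun (congrFun h.eq v) w
  rw [Matrix.mul_apply, Matrix.mul_apply,
    Finset.sum_eq_single u (fun x _ hne => by rcases hx x hne with h | h <;> simp [h])
      (fun hn => absurd (Finset.mem_univ u) hn)] at e
  simpa [hu, hv] using e

/-- A matrix in the commutant of `Δ` and `Δᵀ` is determined by its row at `(0, 0)`. -/
lemma eq_zero_of_commute {M : Matrix (GraphAVertex k) (GraphAVertex k) ℤ}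
    (h : Commute (graphAAdj k) M) (h' : Commute (graphAAdj k)ᵀ M)
    (h₀ : M (vertex 0 0 (Nat.zero_le k)) = 0) : M = 0 := by
  suffices H : ∀ s : ℕ, ∀ v : GraphAVertex k, (v.1.1 : ℕ) + v.1.2 ≤ s → M v = 0 from
    funext fun v => H _ v le_rfl
  intro s
  induction s with
  | zero =>
    intro v hv
    rwa [eq_vertex_iff.2 (⟨by omega, by omega⟩ : (v.1.1 : ℕ) = 0 ∧ (v.1.2 : ℕ) = 0)]
  | succ s ih =>
    intro v hv
    have hvk := v.2
    rcases Nat.lt_or_ge s (v.1.1 + v.1.2) with hs | hs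
    swap
    · exact ih v hs
    rcases Nat.eq_zero_or_pos (v.1.1 : ℕ) with hp | hp
    · refine row_eq_zero_of_commute h' (v := vertex 0 (v.1.2 - 1) (by omega))
        (ih _ (by simp only [vertex]; omega)) ?_ fun x hx => ?_
      · rw [adj_transpose_vertex]
        exact if_pos (by omega)
      · by_cases hxs : (x.1.1 : ℕ) + x.1.2 ≤ s
        · exact Or.inr (ih x hxs)
        · left
          have hne : ¬((x.1.1 : ℕ) = v.1.1 ∧ (x.1.2 : ℕ) = v.1.2) :=
            fun e => hx (vertex_ext e.1 e.2)
          rw [adj_transpose_vertex]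
          exact if_neg (by omega)
    · refine row_eq_zero_of_commute h (v := vertex (v.1.1 - 1) v.1.2 (by omega))
        (ih _ (by simp only [vertex]; omega)) ?_ fun x hx => ?_
      · rw [adj_vertex]
        exact if_pos (by omega)
      · by_cases hxs : (x.1.1 : ℕ) + x.1.2 ≤ s
        · exact Or.inr (ih x hxs)
        · left
          have hne : ¬((x.1.1 : ℕ) = v.1.1 ∧ (x.1.2 : ℕ) = v.1.2) :=
            fun e => hx (vertex_ext e.1 e.2)
          rw [adj_vertex]
          exact if_neg (by omega)

lemma commute_adj_fusion (j : ℕ) : Commute (graphAAdj k) (graphAFusion k j) :=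
  commute_fusion (Commute.refl _) commute_adj_transpose j

lemma commute_adj_transpose_fusion (j : ℕ) : Commute (graphAAdj k)ᵀ (graphAFusion k j) :=
  commute_fusion commute_adj_transpose.symm (Commute.refl _) j

lemma fusion_row_zero (j : ℕ) (hj : j ≤ k) :
    graphAFusion k j (vertex 0 0 (Nat.zero_le k)) = Pi.single (vertex j 0 hj) 1 := by
  induction j using graphAFusion.induct with
  | case1 =>
    ext w
    simp [graphAFusion, Matrix.one_apply, Pi.single_apply, eq_comm]
  | case2 =>
    ext w
    rw [graphAFusion, adj_vertex, Pi.single_apply]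
    simp [eq_vertex_iff]
  | case3 =>
    ext w
    have e : graphAAdj k (vertex 0 0 (Nat.zero_le k)) = Pi.single (vertex 1 0 (by omega)) 1 := by
      ext w
      rw [adj_vertex, Pi.single_apply]
      simp [eq_vertex_iff]
    rw [graphAFusion, Matrix.sub_apply, Matrix.mul_apply_eq_vecMul, e, Matrix.single_one_vecMul]
    simp only [Matrix.row_apply, adj_vertex, adj_transpose_vertex, Pi.single_apply, eq_vertex_iff]
    grind
  | case4 j ih₂ ih₁ ih₀ =>
    ext w
    rw [graphAFusion, (commute_adj_fusion _).eq, (commute_adj_transpose_fusion _).eq,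
      Matrix.add_apply, Matrix.sub_apply, Matrix.mul_apply_eq_vecMul, Matrix.mul_apply_eq_vecMul,
      ih₂ (by omega), ih₁ (by omega), ih₀ (by omega), Matrix.single_one_vecMul,
      Matrix.single_one_vecMul]
    simp only [Matrix.row_apply, adj_vertex, adj_transpose_vertex, Pi.single_apply, eq_vertex_iff]
    grind

lemma fusion_level_eq_perm : graphAFusion k k = graphAPerm k := by
  have hP : Commute (graphAPerm k) (graphAAdj k) := commute_perm adj_sigma
  have hP' : Commute (graphAPerm k) (graphAAdj k)ᵀ :=
    commute_perm fun v w => adj_sigma w v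
  refine sub_eq_zero.1 (eq_zero_of_commute ((commute_adj_fusion k).sub_right hP.symm)
    ((commute_adj_transpose_fusion k).sub_right hP'.symm) ?_)
  ext w
  have e : graphASigma k (vertex 0 0 (Nat.zero_le k)) = vertex k 0 le_rfl := rfl
  rw [Matrix.sub_apply, fusion_row_zero k le_rfl, graphAPerm, e, Pi.single_apply, sub_self]
  rfl

/-- The partial sums of the generating series of the `N_j`, with the remainder terms. -/
lemma hilbert_partial_sum (k n : ℕ) :
    (1 - C (graphAAdj k) * X + C ((graphAAdj k)ᵀ) * X ^ 2 - X ^ 3) *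
      (∑ j ∈ Finset.range (n + 1), C (graphAFusion k j) * X ^ j) =
    1 - C (graphAFusion k (n + 1)) * X ^ (n + 1)
      - C (graphAFusion k (n + 2) - graphAAdj k * graphAFusion k (n + 1)) * X ^ (n + 2)
      - C (graphAFusion k n) * X ^ (n + 3) := by
  induction n with
  | zero =>
    simp only [zero_add, Finset.sum_range_one, graphAFusion, pow_zero, mul_one,
      pow_one, map_one, C_sub, C_mul, sub_mul, one_mul]
    abel
  | succ n ih =>
    have step : ∀ M : Matrix (GraphAVertex k) (GraphAVertex k) ℤ,
        (1 - C (graphAAdj k) * X + C ((graphAAdj k)ᵀ) * X ^ 2 - X ^ 3) * (C M * X ^ (n + 1)) =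
        C M * X ^ (n + 1) - C (graphAAdj k * M) * X ^ (n + 2)
          + C ((graphAAdj k)ᵀ * M) * X ^ (n + 3) - C M * X ^ (n + 4) := by
      intro M
      simp only [sub_mul, add_mul, one_mul, C_mul_X_pow_eq_monomial, C_mul_X_eq_monomial,
        monomial_mul_monomial, X_pow_mul_monomial]
      congr 3 <;> ring_nf
    rw [Finset.sum_range_succ, mul_add, ih, step]
    simp only [graphAFusion, C_sub, C_add, sub_mul, add_mul]
    abel

end GraphA

/-- **Hilbert series of the almost Calabi–Yau algebra of `𝒜⁽ⁿ⁾`**: if the fusion matrices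
truncate, `N_{k+1} = N_{k+2} = 0`, then as polynomials with coefficients in the
(noncommutative) matrix ring one has
`(1 − Δ·t + Δᵀ·t² − 1·t³) · (Σ_{j=0}^{k} N_j·t^j) = 1 − P·t^{k+3}`,
where `P` is the permutation matrix of the order-3 rotation `σ(p,l) = (k−p−l, p)`. -/
theorem hilbertSeries_graphA (k : ℕ) (hk : 1 ≤ k)
    (h1 : graphAFusion k (k + 1) = 0) (h2 : graphAFusion k (k + 2) = 0) :
    (1 - Polynomial.C (graphAAdj k) * Polynomial.X
        + Polynomial.C ((graphAAdj k)ᵀ) * Polynomial.X ^ 2 - Polynomial.X ^ 3) *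
      (∑ j ∈ Finset.range (k + 1), Polynomial.C (graphAFusion k j) * Polynomial.X ^ j) =
    1 - Polynomial.C (graphAPerm k) * Polynomial.X ^ (k + 3) := by
  rw [GraphA.hilbert_partial_sum, h1, h2, GraphA.fusion_level_eq_perm]
  simp
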